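/- arXiv:1301.6540 — 2 statements merged into one kernel-verified Lean document; each statement's English description precedes it below -/
import Mathlib

section
/- There exists a constant C > 0 such that for all sufficiently large n, the variance of the circular crossing number over all partitions of [n] satisfies Var(Y_n) ≤ C·n⁴/(log n)⁴. -/
open Finset

/-- Two elements lie in the same block of the set partition `π` of `[n]`. -/
def sameBlock {n : ℕ} (π : Finpartition (univ : Finset (Fin n))) (a b : Fin n) : Prop :=
  ∃ B ∈ π.parts, a ∈ B ∧ b ∈ B

/-- `(a, b)` is an arc of `π`: `a < b`, they lie in a common block, and no element of that
block lies strictly between them. -/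
def IsArc {n : ℕ} (π : Finpartition (univ : Finset (Fin n))) (a b : Fin n) : Prop :=
  a < b ∧ sameBlock π a b ∧ ∀ c : Fin n, a < c → c < b → ¬ sameBlock π a c

/-- The linear crossing number `cr^ℓ(π)`: the number of pairs of arcs
`((a,b),(c,d))` with `a < c < b < d`. -/
noncomputable def crl {n : ℕ} (π : Finpartition (univ : Finset (Fin n))) : ℕ :=
  Set.ncard {q : (Fin n × Fin n) × (Fin n × Fin n) |
    IsArc π q.1.1 q.1.2 ∧ IsArc π q.2.1 q.2.2 ∧
    q.1.1 < q.2.1 ∧ q.2.1 < q.1.2 ∧ q.1.2 < q.2.2}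

/-- `(a, b)` is a chord of `π`: `a < b` lie in a common block `B`, and either they are
consecutive elements of `B`, or `B` has at least 3 elements and `a = min B`, `b = max B`. -/
def IsChord {n : ℕ} (π : Finpartition (univ : Finset (Fin n))) (a b : Fin n) : Prop :=
  a < b ∧ ∃ B ∈ π.parts, a ∈ B ∧ b ∈ B ∧
    ((∀ c ∈ B, ¬(a < c ∧ c < b)) ∨ (3 ≤ B.card ∧ ∀ c ∈ B, a ≤ c ∧ c ≤ b))

/-- The circular crossing number `cr^c(π)`: the number of unordered pairs of crossing chords,
counted as ordered pairs `((a,b),(c,d))` of chords with `a < c < b < d`. -/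
noncomputable def crc {n : ℕ} (π : Finpartition (univ : Finset (Fin n))) : ℕ :=
  Set.ncard {q : (Fin n × Fin n) × (Fin n × Fin n) |
    IsChord π q.1.1 q.1.2 ∧ IsChord π q.2.1 q.2.2 ∧
    q.1.1 < q.2.1 ∧ q.2.1 < q.1.2 ∧ q.1.2 < q.2.2}

/-- The Stirling number of the second kind `S(n,k)`: the number of set partitions of `[n]`
into exactly `k` blocks. -/
noncomputable def stirling (n k : ℕ) : ℕ :=
  Nat.card {π : Finpartition (univ : Finset (Fin n)) // π.parts.card = k}

/-- Stirling numbers with integer arguments: `S(m,j) = 0` unless `0 ≤ j ≤ m`. -/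
noncomputable def stirlingZ (m j : ℤ) : ℕ :=
  if 0 ≤ m ∧ 0 ≤ j then stirling m.toNat j.toNat else 0

/-- The Bell number `B_n`: the number of set partitions of `[n]`. -/
noncomputable def bell (n : ℕ) : ℕ :=
  Nat.card (Finpartition (univ : Finset (Fin n)))

/-- The set partitions of `[n]` with exactly `k` blocks, as a `Finset`. -/
def Pik (n k : ℕ) : Finset (Finpartition (univ : Finset (Fin n))) :=
  Finset.univ.filter fun π => π.parts.card = k

/-- The mean of the linear crossing number over `Π_n^k`. -/
noncomputable def EX (n k : ℕ) : ℝ :=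
  (∑ π ∈ Pik n k, (crl π : ℝ)) / stirling n k

/-- The variance of the linear crossing number over `Π_n^k`. -/
noncomputable def VarX (n k : ℕ) : ℝ :=
  (∑ π ∈ Pik n k, (crl π : ℝ) ^ 2) / stirling n k - EX n k ^ 2

/-- The mean of the circular crossing number over `Π_n^k`. -/
noncomputable def EY (n k : ℕ) : ℝ :=
  (∑ π ∈ Pik n k, (crc π : ℝ)) / stirling n k

/-- The variance of the circular crossing number over `Π_n^k`. -/
noncomputable def VarY (n k : ℕ) : ℝ :=
  (∑ π ∈ Pik n k, (crc π : ℝ) ^ 2) / stirling n k - EY n k ^ 2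

/-- The mean of the linear crossing number over all of `Π_n`. -/
noncomputable def EXall (n : ℕ) : ℝ :=
  (∑ π : Finpartition (univ : Finset (Fin n)), (crl π : ℝ)) / bell n

/-- The variance of the linear crossing number over all of `Π_n`. -/
noncomputable def VarXall (n : ℕ) : ℝ :=
  (∑ π : Finpartition (univ : Finset (Fin n)), (crl π : ℝ) ^ 2) / bell n - EXall n ^ 2

/-- The mean of the circular crossing number over all of `Π_n`. -/
noncomputable def EYall (n : ℕ) : ℝ :=
  (∑ π : Finpartition (univ : Finset (Fin n)), (crc π : ℝ)) / bell n

/-- The variance of the circular crossing number over all of `Π_n`. -/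
noncomputable def VarYall (n : ℕ) : ℝ :=
  (∑ π : Finpartition (univ : Finset (Fin n)), (crc π : ℝ) ^ 2) / bell n - EYall n ^ 2

/-- The standard normal distribution function `Φ`. -/
noncomputable def stdNormalCDF (x : ℝ) : ℝ :=
  (Real.sqrt (2 * Real.pi))⁻¹ * ∫ t in Set.Iic x, Real.exp (-t ^ 2 / 2)

/-- The average of `F` over all colourings of `Fin n` by the colours `0, …, m - 1`. -/
noncomputable def colouringAvg (m : ℕ) : ∀ n : ℕ, ((Fin n → ℕ) → ℝ) → ℝ
  | 0, F => F Fin.elim0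
  | n + 1, F => (∑ a ∈ range m, colouringAvg m n fun y => F (Fin.cons a y)) / m

/-- Changing the colour of one point changes `F` by at most `D`. -/
def BoundedDiff {n : ℕ} (F : (Fin n → ℕ) → ℝ) (D : ℝ) : Prop :=
  ∀ x i a, |F (Function.update x i a) - F x| ≤ D

lemma BoundedDiff.cons {n : ℕ} {F : (Fin (n + 1) → ℕ) → ℝ} {D : ℝ} (h : BoundedDiff F D)
    (a : ℕ) : BoundedDiff (fun y => F (Fin.cons a y)) D := fun x i b => by
  have := h (Fin.cons a x) i.succ b
  rwa [← Fin.cons_update] at this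

lemma BoundedDiff.cons_sub_cons {n : ℕ} {F : (Fin (n + 1) → ℕ) → ℝ} {D : ℝ}
    (h : BoundedDiff F D) (a b : ℕ) (y : Fin n → ℕ) :
    |F (Fin.cons a y) - F (Fin.cons b y)| ≤ D := by
  have := h (Fin.cons b y) 0 a
  rwa [Fin.update_cons_zero] at this

lemma abs_sum_div_card_sub_le {s : Finset ℕ} (hs : s.Nonempty) {g : ℕ → ℝ} {t D : ℝ}
    (h : ∀ a ∈ s, |g a - t| ≤ D) : |(∑ a ∈ s, g a) / #s - t| ≤ D := by
  have hc : (0 : ℝ) < #s := by exact_mod_cast hs.card_pos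
  have : (∑ a ∈ s, g a) / #s - t = (∑ a ∈ s, (g a - t)) / #s := by
    rw [sum_sub_distrib, sum_const, nsmul_eq_mul]; field_simp
  rw [this, abs_div, abs_of_pos hc, div_le_iff₀ hc]
  calc |∑ a ∈ s, (g a - t)| ≤ ∑ a ∈ s, |g a - t| := abs_sum_le_sum_abs _ _
    _ ≤ ∑ a ∈ s, D := sum_le_sum h
    _ = D * #s := by rw [sum_const, nsmul_eq_mul, mul_comm]

lemma abs_colouringAvg_sub_le {m : ℕ} (hm : 0 < m) {D : ℝ} : ∀ {n : ℕ} {F G : (Fin n → ℕ) → ℝ},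
    (∀ x, |F x - G x| ≤ D) → |colouringAvg m n F - colouringAvg m n G| ≤ D
  | 0, F, G, h => h _
  | n + 1, F, G, h => by
    have hr : (range m).Nonempty := by simpa using hm.ne'
    have := abs_sum_div_card_sub_le (t := 0) hr
      (g := fun a => colouringAvg m n (fun y => F (Fin.cons a y))
        - colouringAvg m n (fun y => G (Fin.cons a y)))
      fun a _ => by
        rw [sub_zero]
        exact abs_colouringAvg_sub_le hm fun y => h (Fin.cons a y)
    simpa [colouringAvg, sum_sub_distrib, sub_div] using this

/-- An Efron–Stein type bound for functions with bounded differences. -/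
lemma colouringAvg_sq_sub_le {m : ℕ} (hm : 0 < m) {D : ℝ} (t : ℝ) :
    ∀ {n : ℕ} {F : (Fin n → ℕ) → ℝ}, BoundedDiff F D →
    colouringAvg m n (fun x => (F x - t) ^ 2) ≤ n * D ^ 2 + (colouringAvg m n F - t) ^ 2
  | 0, F, h => by simp [colouringAvg]
  | n + 1, F, h => by
    have hm' : (0 : ℝ) < m := by exact_mod_cast hm
    have hr : (range m).Nonempty := by simpa using hm.ne'
    set G : ℕ → ℝ := fun a => colouringAvg m n fun y => F (Fin.cons a y) with hG
    set A := colouringAvg m (n + 1) F with hA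
    have hAG : ∑ a ∈ range m, G a = m * A := by
      rw [hA, colouringAvg]; field_simp
      rfl
    have hdiff (a : ℕ) : |G a - A| ≤ D := by
      have := abs_sum_div_card_sub_le (t := G a) hr (g := G) (D := D) fun b _ =>
        abs_colouringAvg_sub_le hm fun y => h.cons_sub_cons b a y
      rw [card_range] at this
      rw [abs_sub_comm]
      exact this
    change (∑ a ∈ range m, colouringAvg m n fun y => (F (Fin.cons a y) - t) ^ 2) / m ≤ _
    rw [div_le_iff₀ hm']
    calc ∑ a ∈ range m, (colouringAvg m n fun y => (F (Fin.cons a y) - t) ^ 2)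
        ≤ ∑ a ∈ range m, (n * D ^ 2 + (D ^ 2 + 2 * (A - t) * (G a - A) + (A - t) ^ 2)) := by
          refine sum_le_sum fun a _ => (colouringAvg_sq_sub_le hm t (h.cons a)).trans ?_
          have h1 : (G a - A) ^ 2 ≤ D ^ 2 := sq_le_sq' (abs_le.1 (hdiff a)).1 (abs_le.1 (hdiff a)).2
          change _ + (G a - t) ^ 2 ≤ _
          nlinarith
      _ = ((n + 1 : ℕ) * D ^ 2 + (A - t) ^ 2) * m := by
          simp only [sum_add_distrib, sum_const, card_range, nsmul_eq_mul, ← mul_sum,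
            sum_sub_distrib, hAG]
          push_cast; ring

lemma abs_colouringAvg_sub_colouringAvg_le {m m' : ℕ} (hm : 0 < m) (hmm : m ≤ m') {D : ℝ} :
    ∀ {n : ℕ} {F : (Fin n → ℕ) → ℝ}, BoundedDiff F D →
    |colouringAvg m n F - colouringAvg m' n F| ≤ n * (D * ((m' - m) / m'))
  | 0, F, h => by simp [colouringAvg]
  | n + 1, F, h => by
    have hm0 : (0 : ℝ) < m := by exact_mod_cast hm
    have hm1 : (0 : ℝ) < m' := by exact_mod_cast hm.trans_le hmm
    have hr : (range m).Nonempty := by simpa using hm.ne'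
    set G : ℕ → ℝ := fun a => colouringAvg m' n fun y => F (Fin.cons a y) with hG
    set U := (∑ a ∈ range m, G a) / m with hU
    have h1 : |colouringAvg m (n + 1) F - U| ≤ n * (D * ((m' - m) / m')) := by
      have := abs_sum_div_card_sub_le (t := 0) hr
        (g := fun a => colouringAvg m n (fun y => F (Fin.cons a y)) - G a)
        fun a _ => by
          rw [sub_zero]
          exact abs_colouringAvg_sub_colouringAvg_le hm hmm (h.cons a)
      simpa [colouringAvg, sum_sub_distrib, sub_div] using this
    have hdiff (a : ℕ) : |G a - U| ≤ D := by
      have := abs_sum_div_card_sub_le (t := G a) hr (g := G) (D := D) fun b _ =>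
        abs_colouringAvg_sub_le (hm.trans_le hmm) fun y => h.cons_sub_cons b a y
      rw [card_range] at this
      rw [abs_sub_comm]
      exact this
    have h2 : |U - colouringAvg m' (n + 1) F| ≤ D * ((m' - m) / m') := by
      have e1 : colouringAvg m' (n + 1) F - U = (∑ a ∈ Ico m m', (G a - U)) / m' := by
        have e2 : ∑ a ∈ range m, G a = m * U := by rw [hU]; field_simp
        change (∑ a ∈ range m', G a) / m' - U = _
        rw [← sum_range_add_sum_Ico _ hmm, e2, sum_sub_distrib, sum_const, Nat.card_Ico,
          nsmul_eq_mul, Nat.cast_sub hmm]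
        field_simp
        ring
      rw [abs_sub_comm, e1, abs_div, abs_of_pos hm1, ← mul_div_assoc]
      gcongr
      calc |∑ a ∈ Ico m m', (G a - U)| ≤ ∑ a ∈ Ico m m', |G a - U| := abs_sum_le_sum_abs _ _
        _ ≤ ∑ a ∈ Ico m m', D := sum_le_sum fun a _ => hdiff a
        _ = D * (m' - m) := by
          rw [sum_const, nsmul_eq_mul, mul_comm, Nat.card_Ico, Nat.cast_sub hmm]
    calc |colouringAvg m (n + 1) F - colouringAvg m' (n + 1) F|
        ≤ |colouringAvg m (n + 1) F - U| + |U - colouringAvg m' (n + 1) F| := abs_sub_le _ _ _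
      _ ≤ n * (D * ((m' - m) / m')) + D * ((m' - m) / m') := add_le_add h1 h2
      _ = (n + 1 : ℕ) * (D * ((m' - m) / m')) := by push_cast; ring

lemma pow_mul_colouringAvg {m : ℕ} (hm : 0 < m) : ∀ {n : ℕ} (F : (Fin n → ℕ) → ℝ),
    m ^ n * colouringAvg m n F = ∑ x : Fin n → Fin m, F fun i => x i
  | 0, F => by simp [colouringAvg]; congr!
  | n + 1, F => by
    have hm' : (m : ℝ) ≠ 0 := by exact_mod_cast hm.ne'
    rw [← (Fin.consEquiv fun _ => Fin m).sum_comp, Fintype.sum_prod_type, colouringAvg,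
      ← Fin.sum_univ_eq_sum_range (fun a => colouringAvg m n fun y => F (Fin.cons a y)),
      pow_succ, mul_assoc, mul_div_cancel₀ _ hm', mul_sum]
    refine sum_congr rfl fun a _ => ?_
    rw [pow_mul_colouringAvg hm]
    refine sum_congr rfl fun y _ => congrArg F ?_
    ext i
    refine Fin.cases ?_ (fun j => ?_) i <;> simp

/-- The Dobiński weight `m ^ n / m!`. -/
noncomputable def dobinskiWeight (n m : ℕ) : ℝ := (m : ℝ) ^ n / m.factorial

lemma sum_dobinskiWeight_mul_sq_sub_le {n c : ℕ} (hn : n ≠ 0) (hc : 0 < c)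
    (h1 : ((c : ℝ) + 1) ^ n ≤ c * c ^ n)
    (h2 : ((c : ℝ) - 1) * (c - 1) ^ n ≤ c ^ n) {N : ℕ} (hN : c < N) :
    ∑ m ∈ range N, dobinskiWeight n m * ((m : ℝ) - c) ^ 2 ≤
      (2 * c + 1) * ∑ m ∈ range N, dobinskiWeight n m := by
  set w := dobinskiWeight n with hw
  set φ : ℕ → ℝ := fun m => w m * m * (m - c) - w m * m with hφ
  have hw0 (m : ℕ) : 0 ≤ w m := by unfold w dobinskiWeight; positivity
  have hc1 : (1 : ℝ) ≤ c := by exact_mod_cast hc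
  have key (m : ℕ) : w m * ((m : ℝ) - c) ^ 2 ≤
      2 * (φ m - φ (m + 1)) + (2 * c + 1) * w m := by
    have hs : φ (m + 1) = ((m : ℝ) + 1) ^ n / m.factorial * (m - c) := by
      simp only [hφ, hw, dobinskiWeight, Nat.factorial_succ]
      push_cast
      field_simp
      ring
    set u := ((m : ℝ) + 1) ^ n / m.factorial with hu
    rw [hs]
    simp only [hφ]
    rcases le_or_gt c m with h | h
    · have hcm : (c : ℝ) ≤ m := by exact_mod_cast h
      have huw : u ≤ c * w m := by
        rw [hu, hw, dobinskiWeight, ← mul_div_assoc]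
        gcongr
        have hm0 : (0 : ℝ) < m := by linarith
        have h3 : ((m : ℝ) + 1) * c ≤ (c + 1) * m := by nlinarith
        have h4 : ((m : ℝ) + 1) ^ n * c ^ n ≤ c * m ^ n * c ^ n := by
          calc ((m : ℝ) + 1) ^ n * c ^ n = (((m : ℝ) + 1) * c) ^ n := (mul_pow _ _ _).symm
            _ ≤ ((c + 1) * m) ^ n := by gcongr
            _ = (c + 1) ^ n * m ^ n := mul_pow _ _ _
            _ ≤ c * c ^ n * m ^ n := by gcongr
            _ = _ := by ring
        exact le_of_mul_le_mul_right h4 (by positivity)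
      nlinarith [mul_le_mul_of_nonneg_right huw (sub_nonneg.2 hcm),
        mul_nonneg (hw0 m) (sq_nonneg ((m : ℝ) - c - 1))]
    · have hcm : (m : ℝ) + 1 ≤ c := by exact_mod_cast h
      have huw : (c - 1) * w m ≤ u := by
        rw [hu, hw, dobinskiWeight, ← mul_div_assoc]
        gcongr
        rcases Nat.eq_zero_or_pos m with rfl | hm
        · simp [hn]
        have hm0 : (0 : ℝ) < m := by exact_mod_cast hm
        have h3 : (m : ℝ) * c ≤ (m + 1) * (c - 1) := by nlinarith
        have hc2 : (0 : ℝ) < c - 1 := by linarith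
        have h4 : (((c : ℝ) - 1) * m ^ n) * (c - 1) ^ n ≤ (m + 1) ^ n * (c - 1) ^ n := by
          calc (((c : ℝ) - 1) * m ^ n) * (c - 1) ^ n = ((c - 1) * (c - 1) ^ n) * m ^ n := by ring
            _ ≤ c ^ n * m ^ n := by gcongr
            _ = (m * c) ^ n := by rw [mul_pow, mul_comm]
            _ ≤ ((m + 1) * (c - 1)) ^ n := by gcongr
            _ = _ := mul_pow _ _ _
        exact le_of_mul_le_mul_right h4 (by positivity)
      nlinarith [mul_le_mul_of_nonneg_right huw (by linarith : (0 : ℝ) ≤ c - m),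
        mul_nonneg (hw0 m) (sq_nonneg ((m : ℝ) - c)), hw0 m]
  have hφN : 0 ≤ φ N := by
    have : (c : ℝ) + 1 ≤ N := by exact_mod_cast hN
    have : φ N = w N * N * (N - c - 1) := by simp only [hφ]; ring
    rw [this]
    exact mul_nonneg (mul_nonneg (hw0 N) (Nat.cast_nonneg N)) (by linarith)
  have hφ0 : φ 0 = 0 := by simp [hφ]
  calc ∑ m ∈ range N, w m * ((m : ℝ) - c) ^ 2
      ≤ ∑ m ∈ range N, (2 * (φ m - φ (m + 1)) + (2 * c + 1) * w m) := sum_le_sum fun m _ => key m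
    _ = 2 * (φ 0 - φ N) + (2 * c + 1) * ∑ m ∈ range N, w m := by
      rw [sum_add_distrib, ← mul_sum, ← mul_sum, sum_range_sub']
    _ ≤ (2 * c + 1) * ∑ m ∈ range N, w m := by linarith

lemma exists_dobinski_mode (n : ℕ) : ∃ c : ℕ, 0 < c ∧ ((c : ℝ) + 1) ^ n ≤ c * c ^ n ∧
    ((c : ℝ) - 1) * (c - 1) ^ n ≤ c ^ n := by
  classical
  have hex : ∃ c : ℕ, 0 < c ∧ ((c : ℝ) + 1) ^ n ≤ c * c ^ n := by
    refine ⟨2 ^ n, by positivity, ?_⟩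
    have h1 : (1 : ℝ) ≤ 2 ^ n := one_le_pow₀ one_le_two
    push_cast
    calc ((2 : ℝ) ^ n + 1) ^ n ≤ (2 * 2 ^ n) ^ n := by gcongr; linarith
      _ = _ := mul_pow _ _ _
  refine ⟨Nat.find hex, (Nat.find_spec hex).1, (Nat.find_spec hex).2, ?_⟩
  obtain ⟨k, hk⟩ : ∃ k, Nat.find hex = k + 1 :=
    Nat.exists_eq_succ_of_ne_zero (Nat.find_spec hex).1.ne'
  have := Nat.find_min hex (m := k) (by omega)
  rw [hk]
  push_cast
  rcases Nat.eq_zero_or_pos k with rfl | h0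
  · simp
  · have h3 := not_le.1 fun h => this ⟨h0, h⟩
    simpa using h3.le

lemma le_sq_of_dobinski_mode {n c : ℕ} (hc : 0 < c) (h : ((c : ℝ) + 1) ^ n ≤ c * c ^ n) :
    (n : ℝ) ≤ c ^ 2 := by
  have hc0 : (0 : ℝ) < c := by exact_mod_cast hc
  have h1 : (1 + 1 / (c : ℝ)) ^ n ≤ c := by
    rw [← mul_le_mul_iff_left₀ (show (0 : ℝ) < c ^ n by positivity), ← mul_pow]
    have h0 : (1 + 1 / (c : ℝ)) * c = c + 1 := by field_simp
    rwa [h0]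
  have h2 := one_add_mul_le_pow (a := 1 / (c : ℝ)) (by
    have : (0 : ℝ) < 1 / c := by positivity
    linarith) n
  have h3 : (n : ℝ) * (1 / c) ≤ c := by linarith
  rw [mul_one_div, div_le_iff₀ hc0] at h3
  linarith [sq (c : ℝ)]

lemma hasSum_descFactorial_div_factorial (k : ℕ) :
    HasSum (fun m : ℕ => (m.descFactorial k : ℝ) / m.factorial) (Real.exp 1) := by
  rw [← hasSum_nat_add_iff' k]
  have h0 : ∑ i ∈ range k, (i.descFactorial k : ℝ) / i.factorial = 0 :=
    sum_eq_zero fun i hi => by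
      rw [Nat.descFactorial_of_lt (mem_range.1 hi)]; simp
  rw [h0, sub_zero]
  have h1 := NormedSpace.expSeries_div_hasSum_exp (1 : ℝ)
  rw [← Real.exp_eq_exp_ℝ] at h1
  have key (m : ℕ) : ((m + k).descFactorial k : ℝ) / (m + k).factorial =
      1 ^ m / m.factorial := by
    have := Nat.factorial_mul_descFactorial (Nat.le_add_left k m)
    rw [Nat.add_sub_cancel] at this
    rw [one_pow, ← this]
    have hd : (m + k).descFactorial k ≠ 0 := by
      rw [Ne, Nat.descFactorial_eq_zero_iff_lt]; omega
    push_cast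
    have : (((m + k).descFactorial k : ℕ) : ℝ) ≠ 0 := by exact_mod_cast hd
    field_simp
  simpa only [key] using h1

open Classical in
/-- The partition of `Fin n` into the colour classes of `x`. -/
noncomputable def colourPart {n : ℕ} (x : Fin n → ℕ) : Finpartition (univ : Finset (Fin n)) :=
  Finpartition.ofSetoid (Setoid.ker x)

open Classical in
lemma mem_colourPart_part {n : ℕ} (x : Fin n → ℕ) (a b : Fin n) :
    b ∈ (colourPart x).part a ↔ x a = x b :=
  Finpartition.mem_part_ofSetoid_iff_rel

lemma mem_parts_iff_exists_part {n : ℕ} (π : Finpartition (univ : Finset (Fin n)))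
    (B : Finset (Fin n)) : B ∈ π.parts ↔ ∃ a, π.part a = B := by
  constructor
  · intro h
    obtain ⟨a, ha⟩ := π.nonempty_of_mem_parts h
    exact ⟨a, π.part_eq_of_mem h ha⟩
  · rintro ⟨a, rfl⟩
    exact π.part_mem.2 (mem_univ a)

lemma colourPart_eq_iff {n : ℕ} (x : Fin n → ℕ) (π : Finpartition (univ : Finset (Fin n))) :
    colourPart x = π ↔ ∀ a b, x a = x b ↔ π.part a = π.part b := by
  have hπ (a b) : b ∈ π.part a ↔ π.part a = π.part b := by
    rw [π.mem_part_iff_part_eq_part (mem_univ b) (mem_univ a), eq_comm]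
  constructor
  · rintro rfl a b
    rw [← mem_colourPart_part, hπ]
  · intro h
    have hp (a) : (colourPart x).part a = π.part a := by
      ext b
      rw [mem_colourPart_part, h, hπ]
    ext B
    simp only [mem_parts_iff_exists_part, hp]

lemma card_colourPart_eq {n m : ℕ} (π : Finpartition (univ : Finset (Fin n))) :
    #{x : Fin n → Fin m | colourPart (fun i => (x i : ℕ)) = π} =
      m.descFactorial #π.parts := by
  classical
  have : m.descFactorial #π.parts = Fintype.card (π.parts ↪ Fin m) := by
    rw [Fintype.card_embedding_eq, Fintype.card_fin, Fintype.card_coe]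
  rw [this, ← card_univ]
  symm
  refine card_bij (fun e _ i => e ⟨π.part i, π.part_mem.2 (mem_univ i)⟩) ?_ ?_ ?_
  · intro e _
    rw [mem_filter, colourPart_eq_iff]
    refine ⟨mem_univ _, fun a b => ?_⟩
    rw [Fin.val_inj, e.injective.eq_iff, Subtype.mk.injEq]
  · intro e _ e' _ h
    ext ⟨B, hB⟩
    obtain ⟨a, rfl⟩ := (mem_parts_iff_exists_part π B).1 hB
    exact congrArg Fin.val (congrFun h a)
  · intro x hx
    rw [mem_filter, colourPart_eq_iff] at hx
    choose r hr using fun B : π.parts => (mem_parts_iff_exists_part π B).1 B.2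
    refine ⟨⟨fun B => x (r B), fun B B' h => Subtype.ext ?_⟩, mem_univ _, ?_⟩
    · rw [← hr B, ← hr B', ← hx.2]
      exact congrArg Fin.val h
    · ext i
      exact (hx.2 _ _).2 (hr _)

/-- The Dobiński formula for sums over set partitions. -/
lemma hasSum_dobinski {n : ℕ} (hn : n ≠ 0) (H : Finpartition (univ : Finset (Fin n)) → ℝ) :
    HasSum (fun m => dobinskiWeight n m * colouringAvg m n fun x => H (colourPart x))
      (Real.exp 1 * ∑ π, H π) := by
  rw [mul_sum]
  have := hasSum_sum (s := univ) fun (π : Finpartition (univ : Finset (Fin n))) _ =>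
    (hasSum_descFactorial_div_factorial #π.parts).mul_right (H π)
  have key (m : ℕ) : (dobinskiWeight n m * colouringAvg m n fun x => H (colourPart x)) =
      ∑ π : Finpartition (univ : Finset (Fin n)),
        (m.descFactorial #π.parts : ℝ) / m.factorial * H π := by
    rcases Nat.eq_zero_or_pos m with rfl | hm
    · rw [dobinskiWeight, Nat.cast_zero, zero_pow hn, zero_div, zero_mul]
      symm
      refine sum_eq_zero fun π _ => ?_
      have : 0 < #π.parts := card_pos.2 (π.parts_nonempty (by
        have : Nonempty (Fin n) := ⟨⟨0, Nat.pos_of_ne_zero hn⟩⟩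
        exact univ_nonempty.ne_empty))
      rw [Nat.descFactorial_of_lt this]
      simp
    · rw [dobinskiWeight, div_mul_eq_mul_div, pow_mul_colouringAvg hm,
        ← sum_fiberwise univ (fun x : Fin n → Fin m => colourPart fun i => (x i : ℕ)), sum_div]
      refine sum_congr rfl fun π _ => ?_
      rw [sum_congr rfl fun x hx => by rw [(mem_filter.1 hx).2], sum_const, card_colourPart_eq,
        nsmul_eq_mul]
      ring
  simpa only [key] using this

/-- A consecutive pair in the colour class of its first element. -/
def IsConsecutive {n : ℕ} (x : Fin n → ℕ) (p : Fin n × Fin n) : Prop :=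
  p.1 < p.2 ∧ x p.1 = x p.2 ∧ ∀ c, x p.1 = x c → ¬(p.1 < c ∧ c < p.2)

/-- The extremal pair of a colour class with at least three elements. -/
def IsExtremal {n : ℕ} (x : Fin n → ℕ) (p : Fin n × Fin n) : Prop :=
  p.1 < p.2 ∧ x p.1 = x p.2 ∧ 3 ≤ #{c | x p.1 = x c} ∧ ∀ c, x p.1 = x c → p.1 ≤ c ∧ c ≤ p.2

lemma isChord_colourPart_iff {n : ℕ} (x : Fin n → ℕ) (p : Fin n × Fin n) :
    IsChord (colourPart x) p.1 p.2 ↔ IsConsecutive x p ∨ IsExtremal x p := by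
  have hp : (colourPart x).part p.1 = ({c | x p.1 = x c} : Finset (Fin n)) := by
    ext c; simp [mem_colourPart_part]
  have hB : IsChord (colourPart x) p.1 p.2 ↔ p.1 < p.2 ∧ x p.1 = x p.2 ∧
      ((∀ c, x p.1 = x c → ¬(p.1 < c ∧ c < p.2)) ∨
        (3 ≤ #{c | x p.1 = x c} ∧ ∀ c, x p.1 = x c → p.1 ≤ c ∧ c ≤ p.2)) := by
    refine and_congr_right fun _ => ?_
    constructor
    · rintro ⟨B, hB, h1, h2, h3⟩
      obtain rfl := (colourPart x).part_eq_of_mem hB h1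
      rw [hp] at h2 h3
      simp only [mem_filter, mem_univ, true_and] at h2 h3
      exact ⟨h2, h3⟩
    · rintro ⟨h2, h3⟩
      refine ⟨(colourPart x).part p.1, (colourPart x).part_mem.2 (mem_univ _), ?_⟩
      rw [hp]
      simpa [h2] using h3
  rw [hB, IsConsecutive, IsExtremal]
  tauto

open Classical in
/-- The set of chords of a partition. -/
noncomputable def chordFinset {n : ℕ} (π : Finpartition (univ : Finset (Fin n))) :
    Finset (Fin n × Fin n) := {p | IsChord π p.1 p.2}

/-- The ordered pairs of crossing elements of a set of pairs. -/
def crossings {n : ℕ} (S : Finset (Fin n × Fin n)) : Finset ((Fin n × Fin n) × (Fin n × Fin n)) :=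
  {q ∈ S ×ˢ S | q.1.1 < q.2.1 ∧ q.2.1 < q.1.2 ∧ q.1.2 < q.2.2}

lemma crc_eq_card_crossings {n : ℕ} (π : Finpartition (univ : Finset (Fin n))) :
    crc π = #(crossings (chordFinset π)) := by
  rw [crc, ← Set.ncard_coe_finset]
  congr 1
  ext q
  simp [crossings, chordFinset, and_assoc]

lemma card_crossings_le {n : ℕ} (S T : Finset (Fin n × Fin n)) :
    #(crossings S) ≤ #(crossings T) + 2 * (#(S \ T) * #S) := by
  have h : crossings S ⊆ crossings T ∪ ((S \ T) ×ˢ S ∪ S ×ˢ (S \ T)) := by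
    intro q hq
    simp only [crossings, mem_filter, mem_product, mem_union, mem_sdiff] at hq ⊢
    tauto
  calc #(crossings S) ≤ #(crossings T) + (#((S \ T) ×ˢ S) + #(S ×ˢ (S \ T))) :=
        (card_le_card h).trans ((card_union_le _ _).trans (by gcongr; exact card_union_le _ _))
    _ = _ := by rw [card_product, card_product]; ring

lemma IsConsecutive.snd_unique {n : ℕ} {x : Fin n → ℕ} {a b b' : Fin n}
    (h : IsConsecutive x (a, b)) (h' : IsConsecutive x (a, b')) : b = b' := by
  simp only [IsConsecutive] at h h'
  have h1 := h.2.2 b' h'.2.1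
  have h2 := h'.2.2 b h.2.1
  grind

lemma IsConsecutive.fst_unique {n : ℕ} {x : Fin n → ℕ} {a a' b : Fin n}
    (h : IsConsecutive x (a, b)) (h' : IsConsecutive x (a', b)) : a = a' := by
  simp only [IsConsecutive] at h h'
  have h1 := h.2.2 a'
  have h2 := h'.2.2 a
  grind

lemma IsExtremal.unique {n : ℕ} {x : Fin n → ℕ} {p q : Fin n × Fin n}
    (h : IsExtremal x p) (h' : IsExtremal x q) (hpq : x p.1 = x q.1) : p = q := by
  simp only [IsExtremal] at h h'
  have h1 := h.2.2.2 q.1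
  have h2 := h.2.2.2 q.2
  have h3 := h'.2.2.2 p.1
  have h4 := h'.2.2.2 p.2
  ext <;> grind

lemma IsConsecutive.unique_of_between {n : ℕ} {x : Fin n → ℕ} {p q : Fin n × Fin n} {i : Fin n}
    (h : IsConsecutive x p) (h' : IsConsecutive x q) (hpq : x p.1 = x q.1)
    (hp : p.1 < i ∧ i < p.2) (hq : q.1 < i ∧ i < q.2) : p = q := by
  simp only [IsConsecutive] at h h'
  have h1 := h.2.2 q.1
  have h2 := h.2.2 q.2
  have h3 := h'.2.2 p.1
  have h4 := h'.2.2 p.2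
  ext <;> grind

lemma card_chordFinset_colourPart_le {n : ℕ} (x : Fin n → ℕ) :
    #(chordFinset (colourPart x)) ≤ 2 * n := by
  classical
  have h : chordFinset (colourPart x) ⊆
      ({p | IsConsecutive x p} : Finset (Fin n × Fin n)) ∪
        ({p | IsExtremal x p} : Finset (Fin n × Fin n)) := by
    intro p hp
    simpa [chordFinset, isChord_colourPart_iff] using hp
  have h1 : #{p | IsConsecutive x p} ≤ n := by
    simpa using card_le_card_of_injOn (t := (univ : Finset (Fin n))) Prod.fst
      (fun _ _ => mem_coe.2 (mem_univ _)) fun p hp q hq hpq => by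
        rcases p with ⟨a, b⟩
        rcases q with ⟨a', b'⟩
        obtain rfl : a = a' := hpq
        simp only [coe_filter, mem_univ, true_and, Set.mem_ofPred_eq] at hp hq
        rw [hp.snd_unique hq]
  have h2 : #{p | IsExtremal x p} ≤ n := by
    simpa using card_le_card_of_injOn (t := (univ : Finset (Fin n))) Prod.fst
      (fun _ _ => mem_coe.2 (mem_univ _)) fun p hp q hq hpq => by
        simp only [coe_filter, mem_univ, true_and, Set.mem_ofPred_eq] at hp hq
        exact hp.unique hq (congrArg x hpq)
  have := (card_le_card h).trans (card_union_le _ _)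
  omega

lemma card_chordFinset_sdiff_le {n : ℕ} {x y : Fin n → ℕ} {i : Fin n} (h : ∀ j ≠ i, x j = y j) :
    #(chordFinset (colourPart x) \ chordFinset (colourPart y)) ≤ 5 := by
  classical
  let S₁ : Finset (Fin n × Fin n) := {p | IsConsecutive x p ∧ p.1 = i}
  let S₂ : Finset (Fin n × Fin n) := {p | IsConsecutive x p ∧ p.2 = i}
  let S₃ : Finset (Fin n × Fin n) := {p | IsConsecutive x p ∧ x p.1 = y i ∧ p.1 < i ∧ i < p.2}
  let S₄ : Finset (Fin n × Fin n) := {p | IsExtremal x p ∧ x p.1 = x i}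
  let S₅ : Finset (Fin n × Fin n) := {p | IsExtremal x p ∧ x p.1 = y i}
  have hsub : chordFinset (colourPart x) \ chordFinset (colourPart y) ⊆
      S₁ ∪ (S₂ ∪ (S₃ ∪ (S₄ ∪ S₅))) := by
    intro p hp
    simp only [chordFinset, isChord_colourPart_iff, mem_sdiff, mem_filter, mem_univ,
      true_and, not_or] at hp
    simp only [S₁, S₂, S₃, S₄, S₅, mem_union, mem_filter, mem_univ, true_and]
    obtain ⟨hx | hx, hc, he⟩ := hp
    · by_cases h1 : p.1 = i
      · exact Or.inl ⟨hx, h1⟩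
      by_cases h2 : p.2 = i
      · exact Or.inr (Or.inl ⟨hx, h2⟩)
      refine Or.inr (Or.inr (Or.inl ⟨hx, ?_⟩))
      by_contra hcon
      refine hc ⟨hx.1, by rw [← h _ h1, ← h _ h2]; exact hx.2.1, fun c hcc hb => ?_⟩
      rw [← h _ h1] at hcc
      by_cases hci : c = i
      · subst hci
        exact hcon ⟨hcc, hb⟩
      · exact hx.2.2 c (by rw [hcc, h _ hci]) hb
    · by_cases h1 : x p.1 = x i
      · exact Or.inr (Or.inr (Or.inr (Or.inl ⟨hx, h1⟩)))
      by_cases h2 : x p.1 = y i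
      · exact Or.inr (Or.inr (Or.inr (Or.inr ⟨hx, h2⟩)))
      exfalso
      have hcl (c) : y p.1 = y c ↔ x p.1 = x c := by
        rw [← h p.1 fun hpi => h1 (by rw [hpi])]
        by_cases hci : c = i
        · subst hci
          simp [h1, h2]
        · rw [h c hci]
      refine he ⟨hx.1, ?_⟩
      simp only [hcl]
      exact hx.2
  have c₁ : #S₁ ≤ 1 := card_le_one.2 fun p hp q hq => by
    simp only [S₁, mem_filter, mem_univ, true_and] at hp hq
    rcases p with ⟨a, b⟩
    rcases q with ⟨a', b'⟩
    obtain rfl : a = a' := hp.2.trans hq.2.symm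
    rw [hp.1.snd_unique hq.1]
  have c₂ : #S₂ ≤ 1 := card_le_one.2 fun p hp q hq => by
    simp only [S₂, mem_filter, mem_univ, true_and] at hp hq
    rcases p with ⟨a, b⟩
    rcases q with ⟨a', b'⟩
    obtain rfl : b = b' := hp.2.trans hq.2.symm
    rw [hp.1.fst_unique hq.1]
  have c₃ : #S₃ ≤ 1 := card_le_one.2 fun p hp q hq => by
    simp only [S₃, mem_filter, mem_univ, true_and] at hp hq
    exact hp.1.unique_of_between hq.1 (hp.2.1.trans hq.2.1.symm) hp.2.2 hq.2.2
  have c₄ : #S₄ ≤ 1 := card_le_one.2 fun p hp q hq => by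
    simp only [S₄, mem_filter, mem_univ, true_and] at hp hq
    exact hp.1.unique hq.1 (hp.2.trans hq.2.symm)
  have c₅ : #S₅ ≤ 1 := card_le_one.2 fun p hp q hq => by
    simp only [S₅, mem_filter, mem_univ, true_and] at hp hq
    exact hp.1.unique hq.1 (hp.2.trans hq.2.symm)
  have d₁ := card_union_le S₄ S₅
  have d₂ := card_union_le S₃ (S₄ ∪ S₅)
  have d₃ := card_union_le S₂ (S₃ ∪ (S₄ ∪ S₅))
  have d₄ := card_union_le S₁ (S₂ ∪ (S₃ ∪ (S₄ ∪ S₅)))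
  have := card_le_card hsub
  omega

lemma crc_colourPart_le {n : ℕ} {x y : Fin n → ℕ} {i : Fin n} (h : ∀ j ≠ i, x j = y j) :
    crc (colourPart x) ≤ crc (colourPart y) + 20 * n := by
  rw [crc_eq_card_crossings, crc_eq_card_crossings]
  refine (card_crossings_le _ (chordFinset (colourPart y))).trans ?_
  have := Nat.mul_le_mul (card_chordFinset_sdiff_le h) (card_chordFinset_colourPart_le x)
  omega

lemma boundedDiff_crc (n : ℕ) :
    BoundedDiff (fun x : Fin n → ℕ => (crc (colourPart x) : ℝ)) (20 * n) := by
  intro x i a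
  have h (j) (hj : j ≠ i) : Function.update x i a j = x j := Function.update_of_ne hj _ _
  have h1 : (crc (colourPart (Function.update x i a)) : ℝ) ≤ crc (colourPart x) + 20 * n := by
    exact_mod_cast crc_colourPart_le h
  have h2 : (crc (colourPart x) : ℝ) ≤ crc (colourPart (Function.update x i a)) + 20 * n := by
    exact_mod_cast crc_colourPart_le fun j hj => (h j hj).symm
  exact abs_sub_le_iff.2 ⟨by linarith, by linarith⟩

lemma VarYall_le_sum_sq_sub (n : ℕ) (t : ℝ) :
    VarYall n ≤ (∑ π : Finpartition (univ : Finset (Fin n)), ((crc π : ℝ) - t) ^ 2) / bell n := by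
  have hb : (bell n : ℝ) = #(univ : Finset (Finpartition (univ : Finset (Fin n)))) := by
    rw [bell, Nat.card_eq_fintype_card, card_univ]
  have hb0 : (bell n : ℝ) ≠ 0 := by
    rw [hb, Nat.cast_ne_zero, Finset.card_ne_zero]
    exact univ_nonempty
  have h : (∑ π : Finpartition (univ : Finset (Fin n)), ((crc π : ℝ) - t) ^ 2) / bell n =
      VarYall n + (EYall n - t) ^ 2 := by
    simp only [VarYall, EYall, sub_sq, sum_add_distrib, sum_sub_distrib, sum_const, ← hb,
      nsmul_eq_mul, ← sum_mul, ← mul_sum]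
    field_simp
    ring
  rw [h]
  nlinarith [sq_nonneg (EYall n - t)]

lemma VarYall_le {n c : ℕ} (hn : n ≠ 0) (hc : 0 < c)
    (h1 : ((c : ℝ) + 1) ^ n ≤ c * c ^ n)
    (h2 : ((c : ℝ) - 1) * (c - 1) ^ n ≤ c ^ n) :
    VarYall n ≤ n * (20 * n) ^ 2 + (n * (20 * n) / c) ^ 2 * (2 * c + 1) := by
  set F : (Fin n → ℕ) → ℝ := fun x => (crc (colourPart x) : ℝ) with hF
  have hBD : BoundedDiff F (20 * n) := boundedDiff_crc n
  set t := colouringAvg c n F with ht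
  have hc0 : (0 : ℝ) < c := by exact_mod_cast hc
  have hw0 (m : ℕ) : 0 ≤ dobinskiWeight n m := by unfold dobinskiWeight; positivity
  have hmean {m : ℕ} (hm : 0 < m) :
      |colouringAvg m n F - t| ≤ n * (20 * n) / c * |(m : ℝ) - c| := by
    have hm0 : (0 : ℝ) < m := by exact_mod_cast hm
    rcases le_total m c with hmc | hmc
    · have hmc' : (m : ℝ) ≤ c := by exact_mod_cast hmc
      refine (abs_colouringAvg_sub_colouringAvg_le hm hmc hBD).trans (le_of_eq ?_)
      rw [abs_of_nonpos (by linarith)]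
      field_simp
      ring
    · have hmc' : (c : ℝ) ≤ m := by exact_mod_cast hmc
      rw [abs_sub_comm, abs_of_nonneg (by linarith : (0 : ℝ) ≤ m - c)]
      calc |t - colouringAvg m n F| ≤ n * (20 * n * ((m - c) / m)) :=
            abs_colouringAvg_sub_colouringAvg_le hc hmc hBD
        _ ≤ n * (20 * n * ((m - c) / c)) := by
          have : (0 : ℝ) ≤ m - c := by linarith
          gcongr
        _ = _ := by ring
  have hterm (m : ℕ) : dobinskiWeight n m * colouringAvg m n (fun x => (F x - t) ^ 2) ≤
      n * (20 * n) ^ 2 * dobinskiWeight n m +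
        (n * (20 * n) / c) ^ 2 * (dobinskiWeight n m * ((m : ℝ) - c) ^ 2) := by
    rcases Nat.eq_zero_or_pos m with rfl | hm
    · simp [dobinskiWeight, hn]
    have h3 : (colouringAvg m n F - t) ^ 2 ≤ (n * (20 * n) / c * ((m : ℝ) - c)) ^ 2 := by
      rw [sq_le_sq, abs_mul, abs_of_nonneg (by positivity : (0 : ℝ) ≤ n * (20 * n) / c)]
      exact hmean hm
    calc dobinskiWeight n m * colouringAvg m n (fun x => (F x - t) ^ 2)
        ≤ dobinskiWeight n m * (n * (20 * n) ^ 2 + (n * (20 * n) / c * ((m : ℝ) - c)) ^ 2) :=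
          mul_le_mul_of_nonneg_left ((colouringAvg_sq_sub_le hm t hBD).trans (by linarith)) (hw0 m)
      _ = _ := by ring
  have hone (m : ℕ) : dobinskiWeight n m * colouringAvg m n (fun _ => (1 : ℝ)) =
      dobinskiWeight n m := by
    rcases Nat.eq_zero_or_pos m with rfl | hm
    · simp [dobinskiWeight, hn]
    · have hm0 : (0 : ℝ) < m := by exact_mod_cast hm
      have := pow_mul_colouringAvg (n := n) hm fun _ => (1 : ℝ)
      rw [sum_const, card_univ, Fintype.card_fun, Fintype.card_fin, Fintype.card_fin,
        nsmul_eq_mul, Nat.cast_pow] at this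
      rw [mul_left_cancel₀ (pow_pos hm0 n).ne' this, mul_one]
  have hS := (hasSum_dobinski hn fun π => ((crc π : ℝ) - t) ^ 2).tendsto_sum_nat
  have hW := (hasSum_dobinski hn fun _ => (1 : ℝ)).tendsto_sum_nat
  simp only [hone] at hW
  set K : ℝ := n * (20 * n) ^ 2 + (n * (20 * n) / c) ^ 2 * (2 * c + 1) with hK
  have hle := le_of_tendsto_of_tendsto hS (hW.const_mul K) (by
    filter_upwards [Filter.eventually_gt_atTop c] with N hN
    calc ∑ m ∈ range N, dobinskiWeight n m * colouringAvg m n (fun x => (F x - t) ^ 2)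
        ≤ ∑ m ∈ range N, (n * (20 * n) ^ 2 * dobinskiWeight n m +
          (n * (20 * n) / c) ^ 2 * (dobinskiWeight n m * ((m : ℝ) - c) ^ 2)) :=
          sum_le_sum fun m _ => hterm m
      _ = n * (20 * n) ^ 2 * ∑ m ∈ range N, dobinskiWeight n m +
          (n * (20 * n) / c) ^ 2 * ∑ m ∈ range N, dobinskiWeight n m * ((m : ℝ) - c) ^ 2 := by
          rw [sum_add_distrib, mul_sum, mul_sum]
      _ ≤ n * (20 * n) ^ 2 * ∑ m ∈ range N, dobinskiWeight n m +
          (n * (20 * n) / c) ^ 2 * ((2 * c + 1) * ∑ m ∈ range N, dobinskiWeight n m) := by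
          gcongr
          exact sum_dobinskiWeight_mul_sq_sub_le hn hc h1 h2 hN
      _ = K * ∑ m ∈ range N, dobinskiWeight n m := by rw [hK]; ring)
  have hb : ∑ π : Finpartition (univ : Finset (Fin n)), (1 : ℝ) = bell n := by
    rw [bell, Nat.card_eq_fintype_card, sum_const, card_univ, nsmul_eq_mul, mul_one]
  have hb0 : (0 : ℝ) < bell n := by
    rw [← hb]
    exact sum_pos (fun _ _ => one_pos) univ_nonempty
  refine (VarYall_le_sum_sq_sub n t).trans ?_
  rw [div_le_iff₀ hb0, ← hb]
  refine le_of_mul_le_mul_left ?_ (Real.exp_pos 1)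
  linarith

/-- Bound on the variance of the circular crossing number over all of `Π_n`:
`Var(Y_n) = O(n⁴ / (log n)⁴)`. -/
theorem var_crc_all_bound :
    ∃ C : ℝ, 0 < C ∧ ∀ᶠ n : ℕ in Filter.atTop,
      VarYall n ≤ C * (n : ℝ) ^ 4 / (Real.log n) ^ 4 := by
  refine ⟨1600, by norm_num, ?_⟩
  have hlog : ∀ᶠ n : ℕ in Filter.atTop, Real.log n ^ 8 ≤ n := by
    have := (Real.isLittleO_pow_log_id_atTop (n := 8)).bound one_pos
    filter_upwards [tendsto_natCast_atTop_atTop.eventually this] with n h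
    simpa using (le_abs_self _).trans h
  filter_upwards [hlog, Filter.eventually_ge_atTop 2] with n hlogn hn
  obtain ⟨c, hc, h1, h2⟩ := exists_dobinski_mode n
  refine (VarYall_le (by omega) hc h1 h2).trans ?_
  have hn2 : (2 : ℝ) ≤ n := by exact_mod_cast hn
  have hc1 : (1 : ℝ) ≤ c := by exact_mod_cast hc
  have hL : 0 < Real.log n := Real.log_pos (by linarith)
  have hcn := le_sq_of_dobinski_mode hc h1
  set L := Real.log n
  have hLc : L ^ 4 ≤ c := by
    refine (le_abs_self _).trans (abs_le_of_sq_le_sq ?_ (by linarith))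
    calc (L ^ 4) ^ 2 = (L ^ 8 : ℝ) := by ring
      _ ≤ (c : ℝ) ^ 2 := hlogn.trans hcn
  have hLn : L ^ 4 ≤ n := by
    refine (le_abs_self _).trans (abs_le_of_sq_le_sq ?_ (by linarith))
    calc (L ^ 4) ^ 2 = (L ^ 8 : ℝ) := by ring
      _ ≤ (n : ℝ) := hlogn
      _ ≤ (n : ℝ) ^ 2 := by nlinarith
  have e1 : (n : ℝ) * (20 * n) ^ 2 ≤ 400 * (n : ℝ) ^ 4 / L ^ 4 := by
    rw [le_div_iff₀ (by positivity)]
    calc (n : ℝ) * (20 * n) ^ 2 * L ^ 4 ≤ n * (20 * n) ^ 2 * n := by gcongr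
      _ = _ := by ring
  have e2 : ((n : ℝ) * (20 * n) / c) ^ 2 * (2 * c + 1) ≤ 1200 * (n : ℝ) ^ 4 / L ^ 4 := by
    calc ((n : ℝ) * (20 * n) / c) ^ 2 * (2 * c + 1) ≤ (n * (20 * n) / c) ^ 2 * (3 * c) := by
          gcongr; linarith
      _ = 1200 * (n : ℝ) ^ 4 / c := by field_simp; ring
      _ ≤ _ := by gcongr
  calc _ ≤ 400 * (n : ℝ) ^ 4 / L ^ 4 + 1200 * (n : ℝ) ^ 4 / L ^ 4 := add_le_add e1 e2
    _ = _ := by ring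
end

section
/- Let M^ℓ_{n,k} denote the maximum of cr^ℓ(π) over all set partitions π of [n] into exactly k blocks. Then for integers n ≥ k ≥ 1: (a) if 1 ≤ k ≤ ⌊n/2⌋, then M^ℓ_{n,k} = (k−1)·n − 3·C(k,2); (b) if ⌈n/2⌉ ≤ k ≤ n, then M^ℓ_{n,k} = C(n−k,2). -/
open Finset

theorem sameBlock_iff_part_eq {n : ℕ} (π : Finpartition (univ : Finset (Fin n))) (a b : Fin n) :
    sameBlock π a b ↔ π.part a = π.part b := by
  constructor
  · rintro ⟨B, hB, ha, hb⟩
    rw [π.part_eq_of_mem hB ha, π.part_eq_of_mem hB hb]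
  · intro h
    exact ⟨π.part a, π.part_mem.2 (mem_univ a), π.mem_part (mem_univ a),
      h ▸ π.mem_part (mem_univ b)⟩

theorem IsArc.right_unique {n : ℕ} {π : Finpartition (univ : Finset (Fin n))} {a b b' : Fin n}
    (h : IsArc π a b) (h' : IsArc π a b') : b = b' := by
  rcases lt_trichotomy b b' with hlt | heq | hlt
  · exact (h'.2.2 b h.1 hlt h.2.1).elim
  · exact heq
  · exact (h.2.2 b' h'.1 hlt h'.2.1).elim

open Classical in
/-- The left endpoints of the arcs of `π`. -/
noncomputable def arcLefts {n : ℕ} (π : Finpartition (univ : Finset (Fin n))) : Finset (Fin n) :=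
  univ.filter fun a => ∃ b, IsArc π a b

theorem mem_arcLefts {n : ℕ} {π : Finpartition (univ : Finset (Fin n))} {a : Fin n} :
    a ∈ arcLefts π ↔ ∃ b, IsArc π a b := by
  simp [arcLefts]

/-- The maximum of a block is not the left endpoint of an arc. -/
theorem card_arcLefts_le {n : ℕ} (π : Finpartition (univ : Finset (Fin n))) :
    (arcLefts π).card ≤ n - π.parts.card := by
  have hle : π.parts.card ≤ (arcLefts π)ᶜ.card := by
    refine Finset.card_le_card_of_surjOn π.part fun B hB => ?_
    have hne := π.nonempty_of_mem_parts hB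
    have hmax := B.max'_mem hne
    refine ⟨B.max' hne, ?_, π.part_eq_of_mem hB hmax⟩
    rw [mem_coe, mem_compl, mem_arcLefts]
    rintro ⟨b, hlt, hsame, -⟩
    rw [sameBlock_iff_part_eq, π.part_eq_of_mem hB hmax] at hsame
    exact absurd (B.le_max' b (hsame ▸ π.mem_part (mem_univ b))) (not_le.2 hlt)
  rw [card_compl, Fintype.card_fin] at hle
  have := card_le_univ (arcLefts π)
  rw [Fintype.card_fin] at this
  omega

theorem Finset.sum_min_card_filter_lt {α : Type*} [LinearOrder α] (s : Finset α) (m : ℕ) :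
    ∑ c ∈ s, min (s.filter (· < c)).card m = ∑ j ∈ range s.card, min j m := by
  induction s using Finset.induction_on_max with
  | empty => simp
  | insert a s ha ih =>
    have hnot : a ∉ s := fun h => lt_irrefl a (ha a h)
    rw [sum_insert hnot, card_insert_of_notMem hnot, sum_range_succ, ← ih, add_comm]
    congr 1
    · refine sum_congr rfl fun c hc => ?_
      rw [filter_insert, if_neg (ha c hc).not_gt]
    · rw [filter_insert, if_neg (lt_irrefl a), filter_true_of_mem ha]

open Classical in
/-- The left endpoints of the arcs of `π` that pass over `c`. -/
noncomputable def arcsOver {n : ℕ} (π : Finpartition (univ : Finset (Fin n))) (c : Fin n) :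
    Finset (Fin n) :=
  univ.filter fun a => a < c ∧ ∃ b, c < b ∧ IsArc π a b

theorem mem_arcsOver {n : ℕ} {π : Finpartition (univ : Finset (Fin n))} {a c : Fin n} :
    a ∈ arcsOver π c ↔ a < c ∧ ∃ b, c < b ∧ IsArc π a b := by
  simp [arcsOver]

/-- Arcs passing over a common element belong to distinct blocks, none of which contains it. -/
theorem card_arcsOver_le {n : ℕ} (π : Finpartition (univ : Finset (Fin n))) (c : Fin n) :
    (arcsOver π c).card ≤ π.parts.card - 1 := by
  have hc : π.part c ∈ π.parts := π.part_mem.2 (mem_univ c)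
  rw [← card_erase_of_mem hc]
  refine card_le_card_of_injOn π.part (fun a ha => ?_) fun a ha a' ha' heq => ?_
  · obtain ⟨hac, b, hcb, -, -, harc⟩ := mem_arcsOver.1 ha
    exact mem_erase.2 ⟨fun h => harc c hac hcb ((sameBlock_iff_part_eq π a c).2 h),
      π.part_mem.2 (mem_univ a)⟩
  · obtain ⟨hac, b, hcb, -, -, harc⟩ := mem_arcsOver.1 ha
    obtain ⟨hac', b', hcb', -, -, harc'⟩ := mem_arcsOver.1 ha'
    rcases lt_trichotomy a a' with hlt | h | hlt
    · exact (harc a' hlt (hac'.trans hcb) ((sameBlock_iff_part_eq π a a').2 heq)).elim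
    · exact h
    · exact (harc' a hlt (hac.trans hcb') ((sameBlock_iff_part_eq π a' a).2 heq.symm)).elim

theorem crl_le_sum_min {n : ℕ} (π : Finpartition (univ : Finset (Fin n))) :
    crl π ≤ ∑ j ∈ range (n - π.parts.card), min j (π.parts.card - 1) := by
  calc crl π
      ≤ ((arcLefts π).sigma (arcsOver π)).card := by
        rw [crl, ← Set.ncard_coe_finset]
        refine Set.ncard_le_ncard_of_injOn (fun q => ⟨q.2.1, q.1.1⟩) ?_ ?_ (Set.toFinite _)
        · rintro ⟨⟨a, b⟩, c, d⟩ ⟨hab, hcd, hac, hcb, -⟩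
          exact mem_coe.2 (mem_sigma.2 ⟨mem_arcLefts.2 ⟨d, hcd⟩, mem_arcsOver.2 ⟨hac, b, hcb, hab⟩⟩)
        · rintro ⟨⟨a, b⟩, c, d⟩ ⟨hab, hcd, -⟩ ⟨⟨a', b'⟩, c', d'⟩ ⟨hab', hcd', -⟩ heq
          simp only [Sigma.mk.injEq, heq_eq_eq] at heq hab hcd hab' hcd'
          obtain ⟨rfl, rfl⟩ := heq
          rw [hab.right_unique hab', hcd.right_unique hcd']
    _ = ∑ c ∈ arcLefts π, (arcsOver π c).card := card_sigma _ _
    _ ≤ ∑ c ∈ arcLefts π, min ((arcLefts π).filter (· < c)).card (π.parts.card - 1) := by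
        refine sum_le_sum fun c _ => le_min (card_le_card fun a ha => ?_) (card_arcsOver_le π c)
        obtain ⟨hac, b, -, hab⟩ := mem_arcsOver.1 ha
        exact mem_filter.2 ⟨mem_arcLefts.2 ⟨b, hab⟩, hac⟩
    _ = ∑ j ∈ range (arcLefts π).card, min j (π.parts.card - 1) :=
        Finset.sum_min_card_filter_lt _ _
    _ ≤ ∑ j ∈ range (n - π.parts.card), min j (π.parts.card - 1) :=
        sum_le_sum_of_subset (range_mono (card_arcLefts_le π))

/-- The partition of `[n]` into residue classes modulo `k`. -/
def residuePartition (n k : ℕ) (hk : 1 ≤ k) (hkn : k ≤ n) :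
    Finpartition (univ : Finset (Fin n)) :=
  Finpartition.ofExistsUnique
    ((range k).image fun r => univ.filter fun i : Fin n => i.val % k = r)
    (fun _ _ => subset_univ _)
    (fun a _ => by
      refine ⟨univ.filter fun i : Fin n => i.val % k = a.val % k,
        ⟨mem_image.2 ⟨_, mem_range.2 (Nat.mod_lt _ hk), rfl⟩, by simp⟩, ?_⟩
      rintro t ⟨ht, hat⟩
      obtain ⟨r, -, rfl⟩ := mem_image.1 ht
      rw [(mem_filter.1 hat).2])
    (by
      intro h
      obtain ⟨r, hr, hempty⟩ := mem_image.1 h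
      have hr := mem_range.1 hr
      have : (⟨r, hr.trans_le hkn⟩ : Fin n) ∈ univ.filter fun i : Fin n => i.val % k = r :=
        mem_filter.2 ⟨mem_univ _, Nat.mod_eq_of_lt hr⟩
      rw [hempty] at this
      exact notMem_empty _ this)

theorem residuePartition_parts (n k : ℕ) (hk : 1 ≤ k) (hkn : k ≤ n) :
    (residuePartition n k hk hkn).parts =
      (range k).image fun r => univ.filter fun i : Fin n => i.val % k = r :=
  rfl

theorem card_residuePartition_parts (n k : ℕ) (hk : 1 ≤ k) (hkn : k ≤ n) :
    (residuePartition n k hk hkn).parts.card = k := by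
  rw [residuePartition_parts, card_image_of_injOn, card_range]
  intro r hr r' _ heq
  have hr := mem_range.1 hr
  have : (⟨r, hr.trans_le hkn⟩ : Fin n) ∈ univ.filter fun i : Fin n => i.val % k = r :=
    mem_filter.2 ⟨mem_univ _, Nat.mod_eq_of_lt hr⟩
  simp only at heq
  rw [heq, mem_filter] at this
  rw [← this.2]
  exact (Nat.mod_eq_of_lt hr).symm

theorem sameBlock_residuePartition (n k : ℕ) (hk : 1 ≤ k) (hkn : k ≤ n) (a b : Fin n) :
    sameBlock (residuePartition n k hk hkn) a b ↔ a.val % k = b.val % k := by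
  rw [sameBlock, residuePartition_parts]
  constructor
  · rintro ⟨B, hB, ha, hb⟩
    obtain ⟨r, -, rfl⟩ := mem_image.1 hB
    rw [(mem_filter.1 ha).2, (mem_filter.1 hb).2]
  · intro h
    exact ⟨_, mem_image.2 ⟨a.val % k, mem_range.2 (Nat.mod_lt _ hk), rfl⟩, by simp, by simp [h]⟩

theorem isArc_residuePartition (n k : ℕ) (hk : 1 ≤ k) (hkn : k ≤ n) {a b : Fin n}
    (hab : b.val = a.val + k) : IsArc (residuePartition n k hk hkn) a b := by
  refine ⟨Fin.lt_def.2 (by omega), ?_, fun c hac hcb hsame => ?_⟩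
  · rw [sameBlock_residuePartition, hab, Nat.add_mod_right]
  · rw [sameBlock_residuePartition] at hsame
    rw [Fin.lt_def] at hac hcb
    have hdvd := (Nat.modEq_iff_dvd' hac.le).1 hsame
    have := Nat.le_of_dvd (by omega) hdvd
    omega

theorem sum_min_le_crl_residuePartition (n k : ℕ) (hk : 1 ≤ k) (hkn : k ≤ n) :
    ∑ j ∈ range (n - k), min j (k - 1) ≤ crl (residuePartition n k hk hkn) := by
  calc ∑ j ∈ range (n - k), min j (k - 1)
      = ((range (n - k)).sigma fun j => Ico (j - (k - 1)) j).card := by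
        rw [card_sigma]
        refine sum_congr rfl fun j _ => ?_
        rw [Nat.card_Ico]
        omega
    _ ≤ crl (residuePartition n k hk hkn) := by
        rw [crl, ← Set.ncard_coe_finset]
        refine le_trans (Set.ncard_le_ncard ?_ (Set.toFinite _))
          (Set.ncard_image_le (f := fun q => (⟨q.2.1.val, q.1.1.val⟩ : Σ _ : ℕ, ℕ))
            (Set.toFinite _))
        rintro ⟨j, i⟩ hji
        obtain ⟨hj, hi⟩ := mem_sigma.1 (mem_coe.1 hji)
        simp only [mem_range, mem_Ico] at hj hi
        refine ⟨((⟨i, by omega⟩, ⟨i + k, by omega⟩), (⟨j, by omega⟩, ⟨j + k, by omega⟩)),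
          ⟨isArc_residuePartition n k hk hkn rfl, isArc_residuePartition n k hk hkn rfl, ?_⟩, rfl⟩
        simp only [Fin.mk_lt_mk]
        omega

theorem isGreatest_crl (n k : ℕ) (hk : 1 ≤ k) (hkn : k ≤ n) :
    IsGreatest {c : ℕ | ∃ π : Finpartition (univ : Finset (Fin n)), π.parts.card = k ∧ crl π = c}
      (∑ j ∈ range (n - k), min j (k - 1)) := by
  have hcard := card_residuePartition_parts n k hk hkn
  constructor
  · refine ⟨residuePartition n k hk hkn, hcard, le_antisymm ?_ ?_⟩
    · simpa only [hcard] using crl_le_sum_min (residuePartition n k hk hkn)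
    · exact sum_min_le_crl_residuePartition n k hk hkn
  · rintro c ⟨π, rfl, rfl⟩
    exact crl_le_sum_min π

theorem sum_range_min_of_le {N m : ℕ} (h : N ≤ m + 1) :
    ∑ j ∈ range N, min j m = N.choose 2 := by
  rw [Nat.choose_two_right, ← sum_range_id]
  refine sum_congr rfl fun j hj => min_eq_left ?_
  have := mem_range.1 hj
  omega

theorem sum_range_add_min (m t : ℕ) :
    ∑ j ∈ range (m + 1 + t), min j m = (m + 1).choose 2 + t * m := by
  rw [sum_range_add, sum_range_min_of_le le_rfl]
  congr 1
  rw [sum_congr rfl fun j _ => min_eq_right (by omega : m ≤ m + 1 + j)]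
  simp

/-- The maximum value of the linear crossing number on `Π_n^k`. -/
theorem max_crl_blocks (n k : ℕ) (hk : 1 ≤ k) (hkn : k ≤ n) :
    (2 * k ≤ n →
      IsGreatest {c : ℕ | ∃ π : Finpartition (univ : Finset (Fin n)),
          π.parts.card = k ∧ crl π = c}
        ((k - 1) * n - 3 * k.choose 2)) ∧
    (n ≤ 2 * k →
      IsGreatest {c : ℕ | ∃ π : Finpartition (univ : Finset (Fin n)),
          π.parts.card = k ∧ crl π = c}
        ((n - k).choose 2)) := by
  have hgreatest := isGreatest_crl n k hk hkn
  refine ⟨fun h => ?_, fun h => ?_⟩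
  · obtain ⟨m, rfl⟩ : ∃ m, k = m + 1 := ⟨k - 1, by omega⟩
    obtain ⟨t, rfl⟩ : ∃ t, n = 2 * (m + 1) + t := ⟨n - 2 * (m + 1), by omega⟩
    rw [show 2 * (m + 1) + t - (m + 1) = m + 1 + t by omega, Nat.add_sub_cancel,
      sum_range_add_min] at hgreatest
    have hchoose : (m + 1).choose 2 * 2 = (m + 1) * m := by
      rw [Nat.choose_two_right, Nat.add_sub_cancel, mul_comm (m + 1)]
      exact Nat.div_mul_cancel (Nat.even_mul_succ_self m).two_dvd
    convert hgreatest using 1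
    rw [Nat.add_sub_cancel, show m * (2 * (m + 1) + t) = 2 * ((m + 1) * m) + t * m by ring,
      ← hchoose]
    omega
  · rwa [sum_range_min_of_le (by omega)] at hgreatest
end
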